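/- arXiv:2604.10868 — 2 statements merged into one kernel-verified Lean document; each statement's English description precedes it below -/
import Mathlib

section
/- Let X be a finite set, p_X ∈ Δ_X, and A := p_X° = {a ∈ ℝ^X : ⟨p_X, a⟩ ≤ 0}. Then for all positive integers n, L and every 0 < ε < 1, the lossless source coding game (A, n, L, ε) is a guaranteed win if and only if there exist functions f_n : Xⁿ → [L] and g_n : [L] → Xⁿ such that P(g_n(f_n(Xⁿ)) ≠ Xⁿ) ≤ ε, where X₁,…,X_n are i.i.d. with distribution p_X. -/
open scoped BigOperators Classical

noncomputable section

/-- The prefix `x^{i-1} = (x_0, …, x_{i-1})` of `x : Fin n → X`, i.e. the first `i` entries. -/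
def prefixOf {X : Type*} {n : ℕ} (x : Fin n → X) (i : Fin n) : Fin i.1 → X :=
  fun j => x ⟨j.1, j.2.trans i.2⟩

/-- `A ⊆ ℝ^X` is a pricing downward closed (DC) cone. -/
def IsDCCone {X : Type*} (A : Set (X → ℝ)) : Prop :=
  (∀ a ∈ A, ∀ γ : ℝ, 0 ≤ γ → γ • a ∈ A) ∧
  (∀ a ∈ A, ∀ b : X → ℝ, (∀ x, 0 ≤ b x) → a - b ∈ A)

/-- The lossless source coding game `(A, n, L, ε)` is a guaranteed win. -/
def SourceGuaranteedWin {X : Type*} (A : Set (X → ℝ)) (n L : ℕ) (ε : ℝ) : Prop :=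
  ∃ (w : (i : Fin n) → (Fin i.1 → X) → (X → ℝ))
    (enc : (Fin n → X) → Fin L) (dec : Fin L → (Fin n → X)),
    (∀ (i : Fin n) (xs : Fin i.1 → X), w i xs ∈ A) ∧
    (∀ x : Fin n → X,
      (∑ i, w i (prefixOf x i) (x i)) - (if dec (enc x) = x then 0 else 1) ≥ -ε)

lemma sum_snoc_aux {X : Type*} [Fintype X] (n : ℕ) (F : (Fin (n+1) → X) → ℝ) :
    ∑ x, F x = ∑ y : Fin n → X, ∑ a : X, F (Fin.snoc (α := fun _ => X) y a) := by
  rw [← (Fin.snocEquiv (fun _ : Fin (n+1) => X)).sum_comp, Fintype.sum_prod_type,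
    Finset.sum_comm]
  rfl

lemma prefix_snoc_castSucc {X : Type*} {n : ℕ} (y : Fin n → X) (a : X) (i : Fin n) :
    prefixOf (Fin.snoc (α := fun _ => X) y a) i.castSucc = prefixOf y i := by
  funext j
  have := Fin.snoc_castSucc (α := fun _ => X) a y ⟨j.1, j.2.trans i.2⟩
  exact this

lemma prefix_snoc_last {X : Type*} {n : ℕ} (y : Fin n → X) (a : X) :
    prefixOf (Fin.snoc (α := fun _ => X) y a) (Fin.last n) = y := by
  funext j
  have := Fin.snoc_castSucc (α := fun _ => X) a y j
  exact this

lemma game_value {X : Type*} [Fintype X]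
    (pX : X → ℝ) (hpX0 : ∀ x, 0 ≤ pX x) (hpX1 : ∑ x, pX x = 1) (n : ℕ) :
    ∀ (h : (Fin n → X) → ℝ) (c : ℝ),
    (∃ w : (i : Fin n) → (Fin i.1 → X) → (X → ℝ),
      (∀ i xs, ∑ x, pX x * w i xs x ≤ 0) ∧
      ∀ x, h x - c ≤ ∑ i, w i (prefixOf x i) (x i)) ↔
    ∑ x, (∏ i, pX (x i)) * h x ≤ c := by
  induction n with
  | zero =>
    intro h c
    constructor
    · rintro ⟨w, -, hw⟩
      have := hw default
      simp at this ⊢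
      convert this
    · intro H
      refine ⟨fun i => i.elim0, fun i => i.elim0, fun x => ?_⟩
      simp at H ⊢
      convert H
  | succ n ih =>
    intro h c
    have key := ih (fun y => ∑ a, pX a * h (Fin.snoc (α := fun _ => X) y a)) c
    have e : ∑ x, (∏ i, pX (x i)) * h x = ∑ y : Fin n → X, (∏ i, pX (y i)) *
        ∑ a, pX a * h (Fin.snoc (α := fun _ => X) y a) := by
      rw [sum_snoc_aux]
      refine Finset.sum_congr rfl fun y _ => ?_
      rw [Finset.mul_sum]
      refine Finset.sum_congr rfl fun a _ => ?_
      rw [Fin.prod_univ_castSucc]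
      simp only [Fin.snoc_castSucc, Fin.snoc_last]
      ring
    rw [e, ← key]
    constructor
    · rintro ⟨w, hwA, hw⟩
      refine ⟨fun i => w i.castSucc, fun i xs => hwA i.castSucc xs, fun y => ?_⟩
      have h1 : ∀ a, h (Fin.snoc (α := fun _ => X) y a) - c ≤
          ∑ i : Fin n, w i.castSucc (prefixOf y i) (y i) + w (Fin.last n) y a := by
        intro a
        have := hw (Fin.snoc (α := fun _ => X) y a)
        rw [Fin.sum_univ_castSucc] at this
        simp only [Fin.snoc_castSucc, Fin.snoc_last, prefix_snoc_castSucc] at this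
        rw [prefix_snoc_last] at this
        exact this
      have h2 := Finset.sum_le_sum (s := Finset.univ)
        fun a _ => mul_le_mul_of_nonneg_left (h1 a) (hpX0 a)
      simp only [mul_sub, mul_add, Finset.sum_sub_distrib, Finset.sum_add_distrib,
        ← Finset.sum_mul, hpX1, one_mul] at h2
      have h3 := hwA (Fin.last n) y
      have h4 : ∑ a, pX a * w (Fin.last n) y a ≤ 0 := h3
      show _ - c ≤ _
      linarith
    · rintro ⟨w, hwA, hw⟩
      let wl : (Fin n → X) → X → ℝ := fun y a => h (Fin.snoc (α := fun _ => X) y a) -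
        ∑ b, pX b * h (Fin.snoc (α := fun _ => X) y b)
      let W : (i : Fin (n+1)) → (Fin i.1 → X) → (X → ℝ) :=
        Fin.lastCases (motive := fun i : Fin (n+1) => (Fin i.1 → X) → (X → ℝ)) wl w
      have Wl : W (Fin.last n) = wl := Fin.lastCases_last
      have Wc : ∀ i : Fin n, W i.castSucc = w i := fun i => Fin.lastCases_castSucc i
      refine ⟨W, fun i => ?_, fun x => ?_⟩
      · induction i using Fin.lastCases with
        | last =>
          intro xs
          rw [Wl]
          simp only [wl, mul_sub, Finset.sum_sub_distrib, ← Finset.sum_mul, hpX1, one_mul]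
          exact (sub_self _).le
        | cast i => intro xs; rw [Wc]; exact hwA i xs
      · obtain ⟨y, a, rfl⟩ : ∃ (y : Fin n → X) (a : X), x = Fin.snoc (α := fun _ => X) y a :=
          ⟨_, _, (Fin.snoc_init_self x).symm⟩
        rw [Fin.sum_univ_castSucc]
        simp only [Fin.snoc_castSucc, Fin.snoc_last, prefix_snoc_castSucc, Wl, Wc]
        rw [prefix_snoc_last]
        have := hw y
        simp only [wl]
        linarith

/-- For `A = p_X°`, the lossless source coding game `(A, n, L, ε)` is a guaranteed win iff
there exists a lossless source coding scheme for the i.i.d. source `p_X` with blocklength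
`n`, codebook size `L` and error probability at most `ε`. -/
theorem source_game_iff_coding_scheme {X : Type*} [Fintype X]
    (pX : X → ℝ) (hpX0 : ∀ x, 0 ≤ pX x) (hpX1 : ∑ x, pX x = 1)
    (n L : ℕ) (hn : 0 < n) (hL : 0 < L) (ε : ℝ) (hε0 : 0 < ε) (hε1 : ε < 1) :
    SourceGuaranteedWin {a : X → ℝ | ∑ x, pX x * a x ≤ 0} n L ε
    ↔ ∃ (f : (Fin n → X) → Fin L) (g : Fin L → (Fin n → X)),
        ∑ xs : Fin n → X,
          (if g (f xs) = xs then 0 else ∏ i, pX (xs i)) ≤ ε := by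
  have key := fun (f : (Fin n → X) → Fin L) (g : Fin L → (Fin n → X)) =>
    game_value pX hpX0 hpX1 n (fun x => if g (f x) = x then 0 else 1) ε
  have e : ∀ (f : (Fin n → X) → Fin L) (g : Fin L → (Fin n → X)),
      ∑ xs : Fin n → X, (if g (f xs) = xs then 0 else ∏ i, pX (xs i)) =
      ∑ x, (∏ i, pX (x i)) * (if g (f x) = x then (0:ℝ) else 1) := by
    intro f g
    refine Finset.sum_congr rfl fun x _ => ?_
    split_ifs <;> simp
  constructor
  · rintro ⟨w, f, g, hA, hw⟩
    refine ⟨f, g, ?_⟩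
    rw [e]
    refine (key f g).1 ⟨w, hA, fun x => ?_⟩
    have := hw x
    show _ - ε ≤ _
    linarith
  · rintro ⟨f, g, H⟩
    rw [e] at H
    obtain ⟨w, hA, hw⟩ := (key f g).2 H
    refine ⟨w, f, g, hA, fun x => ?_⟩
    have := hw x
    linarith

end
end

section
/- Let X be a finite set and A ∈ DCCone(X). Then H(A) = inf_{a ∈ A} sup_{p ∈ Δ_X : ⟨p,a⟩ ≤ 0} H(p), where H(p) := −Σ_{x ∈ supp(p)} p(x) log₂ p(x) is the Shannon entropy; in particular H(A) = −∞ if A = ℝ^X and H(A) = +∞ if A = ∅. -/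
open scoped BigOperators Classical

noncomputable section

/-- The entropy `H(A)` of a pricing DC cone: the infimum of rates `R ≥ 0` such that for all
`n₀` and `0 < ε < 1` there is `n ≥ n₀` making the source coding game
`(A, n, ⌊2^{nR}⌋, ε)` a guaranteed win; by convention `H(ℝ^X) = -∞` (and `sInf ∅ = ⊤`
yields `H(A) = +∞` when no rate is achievable, in particular for `A = ∅`). -/
def gameEntropy {X : Type*} (A : Set (X → ℝ)) : EReal :=
  if A = Set.univ then ⊥ else
    sInf {c : EReal | ∃ R : ℝ, 0 ≤ R ∧ c = (R : EReal) ∧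
      ∀ n₀ : ℕ, 0 < n₀ → ∀ ε : ℝ, 0 < ε → ε < 1 →
        ∃ n, n₀ ≤ n ∧ SourceGuaranteedWin A n ⌊(2 : ℝ) ^ ((n : ℝ) * R)⌋₊ ε}

/-- Probability mass functions on a finite set `X`. -/
def probSimplex (X : Type*) [Fintype X] : Set (X → ℝ) :=
  {p | (∀ x, 0 ≤ p x) ∧ ∑ x, p x = 1}

/-- Shannon entropy in bits, `H(p) = -Σ_{x ∈ supp p} p(x) log₂ p(x)`. -/
def shannonEntropy {X : Type*} [Fintype X] (p : X → ℝ) : ℝ :=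
  ∑ x, (if p x = 0 then 0 else -(p x * Real.logb 2 (p x)))

lemma entropy_nat {X : Type*} [Fintype X] (p : X → ℝ) :
    shannonEntropy p * Real.log 2 = ∑ x, Real.negMulLog (p x) := by
  have h2 : Real.log 2 ≠ 0 := (Real.log_pos (by norm_num)).ne'
  unfold shannonEntropy
  rw [Finset.sum_mul]
  refine Finset.sum_congr rfl fun x _ => ?_
  split_ifs with h
  · simp [h]
  · rw [Real.negMulLog, Real.logb]
    field_simp

lemma gibbs_aux {X : Type*} [Fintype X] (p g : X → ℝ) (hp : p ∈ probSimplex X)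
    (hg : ∀ x, 0 < g x) :
    ∑ x, p x * (Real.log (g x) - Real.log (∑ y, g y)) ≤ - ∑ x, Real.negMulLog (p x) := by
  obtain ⟨hp0, hp1⟩ := hp
  have hne : Nonempty X := by
    by_contra h
    rw [not_nonempty_iff] at h
    simp at hp1
  have hG : 0 < ∑ y, g y := Finset.sum_pos (fun x _ => hg x) Finset.univ_nonempty
  set G := ∑ y, g y with hGdef
  have key : ∀ x, p x * (Real.log (g x) - Real.log G) + Real.negMulLog (p x) ≤ g x / G - p x := by
    intro x
    rcases (hp0 x).eq_or_lt with h | h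
    · rw [← h]; simp; exact (div_pos (hg x) hG).le
    · have h1 := Real.log_le_sub_one_of_pos (div_pos (div_pos (hg x) hG) h)
      rw [Real.log_div (div_pos (hg x) hG).ne' h.ne', Real.log_div (hg x).ne' hG.ne'] at h1
      have h2 := mul_le_mul_of_nonneg_left h1 h.le
      have h3 : p x * (g x / G / p x - 1) = g x / G - p x := by field_simp
      rw [Real.negMulLog]
      linarith
  have := Finset.sum_le_sum (fun x (_ : x ∈ Finset.univ) => key x)
  rw [Finset.sum_add_distrib, Finset.sum_sub_distrib, ← Finset.sum_div, hp1, ← hGdef,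
    div_self hG.ne'] at this
  linarith

lemma exists_nonpos_of_avg {X : Type*} [Fintype X] (p f : X → ℝ) (hp : p ∈ probSimplex X)
    (h : ∑ x, p x * f x ≤ 0) : ∃ x, f x ≤ 0 := by
  obtain ⟨hp0, hp1⟩ := hp
  by_contra! hf
  have h0 : ∀ x, p x = 0 := by
    intro x
    have := (Finset.sum_eq_zero_iff_of_nonneg
      (fun x _ => mul_nonneg (hp0 x) (hf x).le)).1
      (le_antisymm h (Finset.sum_nonneg fun x _ => mul_nonneg (hp0 x) (hf x).le)) x
      (Finset.mem_univ x)
    rcases mul_eq_zero.1 this with h | h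
    · exact h
    · exact absurd h (hf x).ne'
  simp [h0] at hp1

/-- Adversary lemma (deterministic selection). -/
lemma adversary {X : Type*} [Fintype X] (A : Set (X → ℝ)) (r c : ℝ) (hc : 0 ≤ c)
    (hr : ∀ a ∈ A, ∃ p ∈ probSimplex X, ∑ x, p x * a x ≤ 0 ∧ r ≤ ∑ x, Real.negMulLog (p x))
    (hX : Nonempty X) :
    ∀ (n : ℕ) (w : (i : Fin n) → (Fin i.1 → X) → (X → ℝ)) (G : (Fin n → X) → ℝ),
      (∀ i xs, w i xs ∈ A) → (∀ x, 0 < G x) →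
      ∃ x : Fin n → X, (∑ i, w i (prefixOf x i) (x i))
        + c * (n * r + Real.log (G x) - Real.log (∑ y, G y)) ≤ 0 := by
  intro n
  induction n with
  | zero =>
    intro w G _ _
    refine ⟨default, ?_⟩
    simp
  | succ n ih =>
    intro w G hw hG
    obtain ⟨p, hp, hpa, hpr⟩ := hr (w 0 Fin.elim0) (hw _ _)
    set g : X → ℝ := fun x => ∑ y : Fin n → X, G (Fin.cons x y) with hg
    have hgpos : ∀ x, 0 < g x := fun x =>
      Finset.sum_pos (fun y _ => hG _) Finset.univ_nonempty
    have hsum : ∑ y, G y = ∑ x, g x := by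
      rw [hg, ← Fintype.sum_prod_type']
      exact (Equiv.sum_comp (Fin.consEquiv (fun _ : Fin (n+1) => X)) G).symm
    obtain ⟨x0, hx0⟩ := exists_nonpos_of_avg p
      (fun x => w 0 Fin.elim0 x + c * (r + (Real.log (g x) - Real.log (∑ y, g y)))) hp (by
        have h1 := gibbs_aux p g hp hgpos
        have h2 : ∑ x, p x * (w 0 Fin.elim0 x + c * (r + (Real.log (g x) - Real.log (∑ y, g y))))
          = ∑ x, p x * w 0 Fin.elim0 x + c * (r * ∑ x, p x +
            ∑ x, p x * (Real.log (g x) - Real.log (∑ y, g y))) := by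
          simp only [Finset.mul_sum, ← Finset.sum_add_distrib]
          exact Finset.sum_congr rfl fun x _ => by ring
        rw [h2, hp.2]
        have := mul_nonneg hc (show 0 ≤ -(r * 1 +
            ∑ x, p x * (Real.log (g x) - Real.log (∑ y, g y))) by linarith)
        linarith)
    obtain ⟨y, hy⟩ := ih (fun i xs => w i.succ (Fin.cons x0 xs : Fin (i.1+1) → X))
      (fun y => G (Fin.cons x0 y)) (fun i xs => hw _ _) (fun y => hG _)
    refine ⟨Fin.cons x0 y, ?_⟩
    rw [Fin.sum_univ_succ, hsum]
    have e0 : prefixOf (Fin.cons x0 y : Fin (n+1) → X) 0 = Fin.elim0 := by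
      funext j; exact j.elim0
    have e1 : ∀ i : Fin n, prefixOf (Fin.cons x0 y : Fin (n+1) → X) i.succ
        = (Fin.cons x0 (prefixOf y i) : Fin (i.1+1) → X) := by
      intro i
      funext j
      refine Fin.cases ?_ (fun k => ?_) j
      · rfl
      · rfl
    have e2 : ∑ i : Fin n, w i.succ (prefixOf (Fin.cons x0 y : Fin (n+1) → X) i.succ)
        ((Fin.cons x0 y : Fin (n+1) → X) i.succ)
        = ∑ i : Fin n, w i.succ (Fin.cons x0 (prefixOf y i) : Fin (i.1+1) → X) (y i) :=
      Finset.sum_congr rfl fun i _ => by rw [e1, Fin.cons_succ]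
    rw [e2, e0, Fin.cons_zero]
    have e3 : Real.log (g x0) = Real.log (∑ y : Fin n → X, G (Fin.cons x0 y)) := rfl
    beta_reduce at hx0 hy
    rw [← e3] at hy
    push_cast
    linarith

lemma converse_aux {X : Type*} [Fintype X] [Nonempty X] (A : Set (X → ℝ)) (R r : ℝ) (hR : 0 ≤ R)
    (hRr : R < r)
    (hr : ∀ a ∈ A, ∃ p ∈ probSimplex X, ∑ x, p x * a x ≤ 0 ∧ r ≤ shannonEntropy p)
    (hwin : ∀ n₀ : ℕ, 0 < n₀ → ∀ ε : ℝ, 0 < ε → ε < 1 →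
        ∃ n, n₀ ≤ n ∧ SourceGuaranteedWin A n ⌊(2 : ℝ) ^ ((n : ℝ) * R)⌋₊ ε) : False := by
  have hl2 : 0 < Real.log 2 := Real.log_pos (by norm_num)
  set d := (r - R) * Real.log 2 with hd
  have hdpos : 0 < d := mul_pos (by linarith) hl2
  set M := Real.log (Fintype.card X) + 1 with hM
  have hcard1 : (1 : ℝ) ≤ Fintype.card X := by exact_mod_cast Fintype.card_pos
  have hMpos : 1 ≤ M := by
    have := Real.log_nonneg hcard1
    linarith
  obtain ⟨n₀, hn₀⟩ := exists_nat_gt (2 * Real.log 2 / d)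
  -- ε and c
  set ε : ℝ := min (1/4) (d / (8 * M)) with hε
  have hεpos : 0 < ε := lt_min (by norm_num) (by positivity)
  have hε4 : ε ≤ 1/4 := min_le_left _ _
  have hε8 : ε ≤ d / (8 * M) := min_le_right _ _
  obtain ⟨n, hn, hW⟩ := hwin (n₀ + 1) (Nat.succ_pos _) ε hεpos (by linarith)
  have hn1 : (1 : ℝ) ≤ n := by
    have : 1 ≤ n := by omega
    exact_mod_cast this
  have hnn : (n₀ : ℝ) ≤ n := by
    have : n₀ ≤ n := by omega
    exact_mod_cast this
  have hnd : 2 * Real.log 2 < n * d := by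
    have := (div_lt_iff₀ hdpos).1 (lt_of_lt_of_le hn₀ hnn)
    exact this
  set L := ⌊(2 : ℝ) ^ ((n : ℝ) * R)⌋₊ with hL
  obtain ⟨w, enc, dec, hw, hx⟩ := hW
  have hpow1 : (1 : ℝ) ≤ 2 ^ ((n : ℝ) * R) :=
    Real.one_le_rpow (by norm_num) (by positivity)
  have hL1 : 1 ≤ L := Nat.le_floor (by simpa using hpow1)
  have hLpos : (0 : ℝ) < L := by exact_mod_cast hL1
  have hLle : (L : ℝ) ≤ 2 ^ ((n : ℝ) * R) := Nat.floor_le (by positivity)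
  have hlogL : Real.log L ≤ n * R * Real.log 2 := by
    have := Real.log_le_log hLpos hLle
    rwa [Real.log_rpow (by norm_num)] at this
  set S : Finset (Fin n → X) := Finset.univ.image dec with hS
  have hSc : (S.card : ℝ) ≤ L := by
    have : S.card ≤ L := by
      simpa using (Finset.card_image_le (s := Finset.univ) (f := dec))
    exact_mod_cast this
  set N : ℝ := (Fintype.card X : ℝ) ^ n with hN
  have hNpos : 0 < N := by positivity
  set G : (Fin n → X) → ℝ := fun x => (if x ∈ S then 1 / (L : ℝ) else 0) + 1 / N with hG
  have hGpos : ∀ x, 0 < G x := by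
    intro x
    simp only [hG]
    split_ifs <;> positivity
  have hGsum : ∑ x, G x ≤ 2 := by
    simp only [hG, Finset.sum_add_distrib, ← Finset.sum_filter, Finset.sum_const, nsmul_eq_mul]
    have h1 : ((Finset.univ.filter (fun x => x ∈ S)).card : ℝ) = S.card := by
      congr 2
      ext x; simp
    rw [h1]
    have h2 : ((Finset.univ : Finset (Fin n → X)).card : ℝ) = N := by
      simp [hN]
    rw [h2]
    have h3 : (S.card : ℝ) * (1 / L) ≤ 1 := by
      rw [mul_one_div, div_le_one hLpos]; exact hSc
    have h4 : N * (1 / N) = 1 := by field_simp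
    linarith
  have hGsumpos : 0 < ∑ x, G x := Finset.sum_pos (fun x _ => hGpos x) Finset.univ_nonempty
  have hlogsum : Real.log (∑ x, G x) ≤ Real.log 2 := Real.log_le_log hGsumpos hGsum
  set c : ℝ := 1 / (2 * M * n) with hc
  have hcpos : 0 < c := by positivity
  obtain ⟨x, hxx⟩ := adversary A (r * Real.log 2) c hcpos.le (by
    intro a ha
    obtain ⟨p, hp, h1, h2⟩ := hr a ha
    refine ⟨p, hp, h1, ?_⟩
    rw [← entropy_nat]
    exact mul_le_mul_of_nonneg_right h2 hl2.le) inferInstance n w G hw hGpos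
  have hwx := hx x
  have hr0 : 0 < r := by linarith
  by_cases hcor : dec (enc x) = x
  · rw [if_pos hcor] at hwx
    have hxS : x ∈ S := by
      rw [hS, Finset.mem_image]; exact ⟨enc x, Finset.mem_univ _, hcor⟩
    have hlg : - (n * R * Real.log 2) ≤ Real.log (G x) := by
      have h1 : 1 / (L : ℝ) ≤ G x := by
        simp only [hG, if_pos hxS]
        have : 0 < 1 / N := by positivity
        linarith
      have h2 := Real.log_le_log (by positivity) h1
      rw [one_div, Real.log_inv] at h2
      linarith
    have h5 : n * d - Real.log 2 ≤ n * (r * Real.log 2) + Real.log (G x) - Real.log (∑ y, G y) := by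
      rw [hd]; linarith
    have h6 : n * d / 2 < n * (r * Real.log 2) + Real.log (G x) - Real.log (∑ y, G y) := by
      linarith
    have h7 := mul_lt_mul_of_pos_left h6 hcpos
    have h8 : c * (n * d / 2) = d / (4 * M) := by
      rw [hc]; field_simp; norm_num
    have h9 : d / (8 * M) < d / (4 * M) := by
      apply div_lt_div_of_pos_left hdpos (by positivity); linarith
    linarith
  · rw [if_neg hcor] at hwx
    have hlg : - (n * (M - 1)) ≤ Real.log (G x) := by
      have h1 : 1 / N ≤ G x := by
        simp only [hG]
        split_ifs
        · have : 0 < 1 / (L : ℝ) := by positivity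
          linarith
        · linarith
      have h2 := Real.log_le_log (by positivity) h1
      rw [one_div, Real.log_inv, hN, Real.log_pow] at h2
      rw [hM]; simp only [add_sub_cancel_right]; linarith
    have hl21 : Real.log 2 ≤ 1 := by
      have := Real.log_le_sub_one_of_pos (show (0:ℝ) < 2 by norm_num)
      linarith
    have h5 : -(n * M) ≤ n * (r * Real.log 2) + Real.log (G x) - Real.log (∑ y, G y) := by
      have : 0 ≤ n * (r * Real.log 2) := by positivity
      linarith
    have h7 := mul_le_mul_of_nonneg_left h5 hcpos.le
    have h8 : c * (-(n * M)) = -(1/2) := by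
      rw [hc]; field_simp
    linarith

lemma telescope (n : ℕ) (b : Fin n → ℝ) :
    ∑ i : Fin n, (∏ j : Fin i.1, (1 + b ⟨j.1, j.2.trans i.2⟩)) * b i = ∏ i, (1 + b i) - 1 := by
  induction n with
  | zero => simp
  | succ n ih =>
    rw [Fin.sum_univ_castSucc, Fin.prod_univ_castSucc]
    have := ih (fun i => b i.castSucc)
    have e : ∑ i : Fin n, (∏ j : Fin i.castSucc.1, (1 + b ⟨j.1, j.2.trans i.castSucc.2⟩)) * b i.castSucc
      = ∏ i : Fin n, (1 + b i.castSucc) - 1 := this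
    rw [e]
    have e2 : (∏ j : Fin (Fin.last n).1, (1 + b ⟨j.1, j.2.trans (Fin.last n).2⟩))
      = ∏ i : Fin n, (1 + b i.castSucc) := rfl
    rw [e2]; ring

lemma exists_code {Y : Type*} [Fintype Y] [Nonempty Y] (B : Finset Y) (L : ℕ) (hL : 1 ≤ L) (hB : B.card ≤ L) :
    ∃ (enc : Y → Fin L) (dec : Fin L → Y), ∀ x ∈ B, dec (enc x) = x := by
  obtain ⟨f⟩ : Nonempty (B ↪ Fin L) :=
    Function.Embedding.nonempty_of_card_le (by simpa using hB)
  refine ⟨fun x => if h : x ∈ B then f ⟨x, h⟩ else ⟨0, hL⟩,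
    Function.extend f Subtype.val (fun _ => Classical.arbitrary Y), fun x hx => ?_⟩
  beta_reduce
  rw [dif_pos hx, f.injective.extend_apply]

lemma achiev_aux {X : Type*} [Fintype X] [Nonempty X] (A : Set (X → ℝ)) (hA : IsDCCone A)
    (a : X → ℝ) (ha : a ∈ A) (lam R : ℝ) (hlam : 0 ≤ lam) (hR : 0 ≤ R)
    (hZ : ∑ x, Real.exp (-lam * a x) < 2 ^ R) (n₀ : ℕ) (ε : ℝ) (hε : 0 < ε) :
    ∃ n, n₀ ≤ n ∧ SourceGuaranteedWin A n ⌊(2 : ℝ) ^ ((n : ℝ) * R)⌋₊ ε := by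
  have ht : Filter.Tendsto (fun N : ℝ => ∑ x, Real.exp (-lam * (N * Real.log (1 + a x / N))))
      Filter.atTop (nhds (∑ x, Real.exp (-lam * a x))) := by
    refine tendsto_finsetSum _ fun x _ => ?_
    exact (Real.continuous_exp.tendsto _).comp
      ((Real.tendsto_mul_log_one_add_div_atTop (a x)).const_mul (-lam))
  have hpos : ∀ x, ∀ᶠ N : ℝ in Filter.atTop, 0 < 1 + a x / N := by
    intro x
    filter_upwards [Filter.eventually_gt_atTop (|a x|)] with N hN
    have h0 : 0 < N := lt_of_le_of_lt (abs_nonneg _) hN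
    have h1 : -1 < a x / N := by
      rw [lt_div_iff₀ h0]
      have := neg_abs_le (a x)
      linarith
    linarith
  obtain ⟨N, hN1, hN2, hN0⟩ := ((ht.eventually_lt_const hZ).and
    ((Filter.eventually_all.2 hpos).and (Filter.eventually_gt_atTop 0))).exists
  set Z := ∑ x, Real.exp (-lam * (N * Real.log (1 + a x / N))) with hZdef
  have hZpos : 0 < Z := Finset.sum_pos (fun x _ => Real.exp_pos _) Finset.univ_nonempty
  -- choose n large
  have hratio : 1 < 2 ^ R / Z := by rw [one_lt_div hZpos]; exact hN1
  obtain ⟨n, hn, hn'⟩ := ((tendsto_pow_atTop_atTop_of_one_lt hratio).eventually_ge_atTop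
    (Real.exp (-(lam * N) * Real.log ε))).and (Filter.eventually_ge_atTop n₀) |>.exists
  refine ⟨n, hn', ?_⟩
  have hnZ : Real.exp (-(lam * N) * Real.log ε) * Z ^ n ≤ 2 ^ ((n : ℝ) * R) := by
    rw [div_pow, le_div_iff₀ (by positivity)] at hn
    rwa [mul_comm (n : ℝ) R, Real.rpow_mul (by norm_num), Real.rpow_natCast]
  set B : Finset (Fin n → X) := Finset.univ.filter (fun x => ε * ∏ i, (1 + a (x i) / N) < 1) with hB
  have hBcard : (B.card : ℝ) ≤ 2 ^ ((n : ℝ) * R) := by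
    refine le_trans ?_ hnZ
    have e1 : Real.exp (-(lam * N) * Real.log ε) * Z ^ n = ∑ x : Fin n → X,
        Real.exp (-(lam * N) * Real.log ε) *
          ∏ i, Real.exp (-lam * (N * Real.log (1 + a (x i) / N))) := by
      rw [← Finset.mul_sum, hZdef, Finset.sum_pow', Fintype.piFinset_univ]
    rw [e1]
    calc (B.card : ℝ) = ∑ x ∈ B, (1 : ℝ) := by simp
      _ ≤ ∑ x ∈ B, Real.exp (-(lam * N) * Real.log ε) *
          ∏ i, Real.exp (-lam * (N * Real.log (1 + a (x i) / N))) := by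
        refine Finset.sum_le_sum fun x hx => ?_
        rw [hB, Finset.mem_filter] at hx
        have hx := hx.2
        have hpp : 0 < ∏ i, (1 + a (x i) / N) := Finset.prod_pos fun i _ => hN2 _
        have hlog := Real.log_neg (mul_pos hε hpp) hx
        rw [Real.log_mul hε.ne' hpp.ne', Real.log_prod (fun i _ => (hN2 _).ne')] at hlog
        rw [← Real.exp_sum, ← Real.exp_add, Real.one_le_exp_iff]
        have : -(lam * N) * Real.log ε + ∑ i, -lam * (N * Real.log (1 + a (x i) / N))
          = (lam * N) * -(Real.log ε + ∑ i, Real.log (1 + a (x i) / N)) := by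
          rw [← Finset.mul_sum, ← Finset.mul_sum]; ring
        rw [this]
        exact mul_nonneg (by positivity) (by linarith)
      _ ≤ _ := by
        refine Finset.sum_le_sum_of_subset_of_nonneg (Finset.subset_univ _) fun x _ _ => ?_
        exact mul_nonneg (Real.exp_pos _).le (Finset.prod_nonneg fun i _ => (Real.exp_pos _).le)
  have hL1 : 1 ≤ ⌊(2 : ℝ) ^ ((n : ℝ) * R)⌋₊ := Nat.le_floor (by
    simpa using Real.one_le_rpow (x := 2) (by norm_num) (show 0 ≤ (n : ℝ) * R by positivity))
  obtain ⟨enc, dec, hcode⟩ := exists_code B _ hL1 (Nat.le_floor hBcard)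
  refine ⟨fun i xs => (ε * (∏ j, (1 + a (xs j) / N)) * (1 / N)) • a, enc, dec, ?_, ?_⟩
  · intro i xs
    refine hA.1 a ha _ ?_
    have : 0 < ∏ j, (1 + a (xs j) / N) := Finset.prod_pos fun i _ => hN2 _
    positivity
  · intro x
    have hpp : 0 < ∏ i, (1 + a (x i) / N) := Finset.prod_pos fun i _ => hN2 _
    have hs : ∑ i : Fin n, ((ε * (∏ j, (1 + a (prefixOf x i j) / N)) * (1 / N)) • a) (x i)
        = ε * (∏ i, (1 + a (x i) / N) - 1) := by
      rw [← telescope n (fun i => a (x i) / N), Finset.mul_sum]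
      refine Finset.sum_congr rfl fun i _ => ?_
      simp only [Pi.smul_apply, smul_eq_mul, prefixOf]
      ring
    rw [hs]
    have := mul_pos hε hpp
    split_ifs with h
    · linarith
    · have hxB : x ∉ B := fun hx => h (hcode x hx)
      rw [hB, Finset.mem_filter] at hxB
      have : 1 ≤ ε * ∏ i, (1 + a (x i) / N) := by
        by_contra! hlt
        exact hxB ⟨Finset.mem_univ _, hlt⟩
      linarith

lemma tilted {X : Type*} [Fintype X] [Nonempty X] (a : X → ℝ) (lam : ℝ)
    (h1 : ∑ x, a x * Real.exp (-lam * a x) ≤ 0)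
    (h2 : lam * ∑ x, a x * Real.exp (-lam * a x) = 0) :
    ∃ p ∈ probSimplex X, ∑ x, p x * a x ≤ 0 ∧
      Real.log (∑ x, Real.exp (-lam * a x)) ≤ ∑ x, Real.negMulLog (p x) := by
  set Z := ∑ x, Real.exp (-lam * a x) with hZdef
  have hZpos : 0 < Z := Finset.sum_pos (fun x _ => Real.exp_pos _) Finset.univ_nonempty
  have hs : ∑ x, Real.exp (-lam * a x) / Z * a x
      = (∑ x, a x * Real.exp (-lam * a x)) / Z := by
    rw [Finset.sum_div]
    exact Finset.sum_congr rfl fun x _ => by ring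
  have h3 : ∑ x, Real.exp (-lam * a x) / Z = 1 := by
    rw [← Finset.sum_div, ← hZdef, div_self hZpos.ne']
  refine ⟨fun x => Real.exp (-lam * a x) / Z, ⟨fun x => by positivity, h3⟩, ?_, ?_⟩
  · rw [hs]
    exact div_nonpos_of_nonpos_of_nonneg h1 hZpos.le
  · refine le_of_eq ?_
    have : ∀ x, Real.negMulLog (Real.exp (-lam * a x) / Z) =
        lam * (Real.exp (-lam * a x) / Z * a x) + Real.log Z * (Real.exp (-lam * a x) / Z) := by
      intro x
      rw [Real.negMulLog, Real.log_div (Real.exp_pos _).ne' hZpos.ne', Real.log_exp]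
      ring
    simp only [this]
    rw [Finset.sum_add_distrib, ← Finset.mul_sum, ← Finset.mul_sum, hs, h3, ← mul_div_assoc, h2]
    simp

lemma duality {X : Type*} [Fintype X] (a : X → ℝ) (ha : ∃ x, a x ≤ 0) (δ : ℝ)
    (hδ : 0 < δ) :
    ∃ lam : ℝ, 0 ≤ lam ∧ ∃ p ∈ probSimplex X, ∑ x, p x * a x ≤ 0 ∧
      Real.log (∑ x, Real.exp (-lam * a x)) < (∑ x, Real.negMulLog (p x)) + δ := by
  obtain ⟨x1, hx1⟩ := ha
  haveI : Nonempty X := ⟨x1⟩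
  by_cases hneg : ∃ x0, a x0 < 0
  · obtain ⟨x0, hx0⟩ := hneg
    have : ∃ lam : ℝ, 0 ≤ lam ∧ ∑ x, a x * Real.exp (-lam * a x) ≤ 0 ∧
      lam * ∑ x, a x * Real.exp (-lam * a x) = 0 := by
      by_cases h0 : ∑ x, a x ≤ 0
      · exact ⟨0, le_rfl, by simpa using h0, by simp⟩
      · push Not at h0
        set l : ℝ := (∑ x, |a x|) / (a x0) ^ 2 with hl
        have hsq : 0 < (a x0) ^ 2 := by have := hx0.ne; positivity
        have hl0 : 0 ≤ l := div_nonneg (Finset.sum_nonneg fun x _ => abs_nonneg _) hsq.le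
        have hle : ∑ x, a x * Real.exp (-l * a x) ≤ 0 := by
          have hb : ∀ x, a x * Real.exp (-l * a x) ≤ |a x| + if x = x0 then -(l * (a x0)^2) else 0 := by
            intro x
            split_ifs with hx
            · subst hx
              have h1 := Real.add_one_le_exp (-l * a x)
              have h2 := mul_le_mul_of_nonpos_left h1 hx0.le
              have h3 : 0 ≤ |a x| := abs_nonneg _
              nlinarith
            · rw [add_zero]
              rcases le_total (a x) 0 with h | h
              · exact le_trans (mul_nonpos_of_nonpos_of_nonneg h (Real.exp_pos _).le) (abs_nonneg _)
              · rw [abs_of_nonneg h]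
                refine mul_le_of_le_one_right h ?_
                rw [Real.exp_le_one_iff]
                nlinarith
          refine (Finset.sum_le_sum fun x _ => hb x).trans ?_
          rw [Finset.sum_add_distrib, Finset.sum_ite_eq' Finset.univ x0, if_pos (Finset.mem_univ _)]
          rw [hl, div_mul_cancel₀ _ hsq.ne']
          simp
        have hcont : ContinuousOn (fun l : ℝ => ∑ x, a x * Real.exp (-l * a x)) (Set.Icc 0 l) := by
          fun_prop
        obtain ⟨m, hm, hm2⟩ := intermediate_value_Icc' hl0 hcont
          (show (0:ℝ) ∈ Set.Icc _ _ from ⟨hle, by simpa using h0.le⟩)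
        exact ⟨m, hm.1, hm2.le, by simp only [] at hm2; rw [hm2, mul_zero]⟩
    obtain ⟨lam, hlam, h1, h2⟩ := this
    obtain ⟨p, hp, hp1, hp2⟩ := tilted a lam h1 h2
    exact ⟨lam, hlam, p, hp, hp1, by linarith⟩
  · push Not at hneg
    have hx10 : a x1 = 0 := le_antisymm hx1 (hneg x1)
    set m : ℝ := ∑ x, if a x = 0 then (1:ℝ) else 0 with hm
    have hmpos : 0 < m := by
      refine Finset.sum_pos' (fun x _ => by split_ifs <;> norm_num) ⟨x1, Finset.mem_univ _, ?_⟩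
      simp [hx10]
    have ht : Filter.Tendsto (fun l : ℝ => ∑ x, Real.exp (-l * a x)) Filter.atTop (nhds m) := by
      refine tendsto_finsetSum _ fun x _ => ?_
      split_ifs with h
      · simp [h]
      · have hp : 0 < a x := lt_of_le_of_ne (hneg x) (Ne.symm h)
        refine Real.tendsto_exp_atBot.comp ?_
        have := (Filter.tendsto_neg_atTop_atBot (G := ℝ)).atBot_mul_const hp
        exact this
    have ht2 := ht.log hmpos.ne'
    obtain ⟨l, hl, hl0⟩ := ((ht2.eventually_lt_const (show Real.log m < Real.log m + δ by linarith)).and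
      (Filter.eventually_ge_atTop 0)).exists
    refine ⟨l, hl0, fun x => if a x = 0 then 1 / m else 0, ⟨fun x => ?_, ?_⟩, ?_, ?_⟩
    · dsimp only; split_ifs <;> positivity
    · have : ∀ x, (if a x = 0 then 1 / m else 0) = (if a x = 0 then (1:ℝ) else 0) / m := by
        intro x; split_ifs <;> simp
      simp only [this]
      rw [← Finset.sum_div, ← hm, div_self hmpos.ne']
    · refine le_of_eq (Finset.sum_eq_zero fun x _ => ?_)
      beta_reduce
      split_ifs with h <;> simp [h]
    · have : ∀ x, Real.negMulLog (if a x = 0 then 1 / m else 0)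
          = (if a x = 0 then (1:ℝ) else 0) * (Real.log m / m) := by
        intro x; split_ifs
        · rw [Real.negMulLog, one_div, Real.log_inv]; field_simp
        · simp
      simp only [this]
      rw [← Finset.sum_mul, ← hm, mul_div_cancel₀ _ hmpos.ne']
      exact hl

lemma entropy_nonneg_aux {X : Type*} [Fintype X] (p : X → ℝ) (hp : p ∈ probSimplex X) :
    0 ≤ shannonEntropy p := by
  have hl2 : 0 < Real.log 2 := Real.log_pos (by norm_num)
  have h : 0 ≤ shannonEntropy p * Real.log 2 := by
    rw [entropy_nat]
    refine Finset.sum_nonneg fun x _ => Real.negMulLog_nonneg (hp.1 x) ?_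
    rw [← hp.2]
    exact Finset.single_le_sum (fun y _ => hp.1 y) (Finset.mem_univ x)
  exact nonneg_of_mul_nonneg_left h hl2

lemma exists_nonpos_of_proper {X : Type*} [Fintype X] (A : Set (X → ℝ)) (hA : IsDCCone A)
    (hne : A ≠ Set.univ) (a : X → ℝ) (ha : a ∈ A) : ∃ x, a x ≤ 0 := by
  by_contra! h
  apply hne
  rw [Set.eq_univ_iff_forall]
  intro f
  set γ : ℝ := ∑ x, |f x| / a x with hγ
  have hγ0 : 0 ≤ γ := Finset.sum_nonneg fun x _ => div_nonneg (abs_nonneg _) (h x).le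
  have := hA.2 _ (hA.1 a ha γ hγ0) (γ • a - f) (fun x => by
    have h1 : |f x| / a x ≤ γ :=
      Finset.single_le_sum (f := fun x => |f x| / a x)
        (fun y _ => div_nonneg (abs_nonneg _) (h y).le) (Finset.mem_univ x)
    rw [div_le_iff₀ (h x)] at h1
    have := le_abs_self (f x)
    simp only [Pi.sub_apply, Pi.smul_apply, smul_eq_mul]
    linarith)
  simpa using this

/-- The entropy of a pricing DC cone over a finite set equals
`inf_{a ∈ A} sup_{p ∈ Δ_X : ⟨p,a⟩ ≤ 0} H(p)`; in particular it is `-∞` when `A = ℝ^X`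
and `+∞` when `A = ∅`. -/
theorem gameEntropy_eq {X : Type*} [Fintype X]
    (A : Set (X → ℝ)) (hA : IsDCCone A) :
    gameEntropy A
        = ⨅ a ∈ A, ⨆ p ∈ {p ∈ probSimplex X | ∑ x, p x * a x ≤ 0},
            ((shannonEntropy p : ℝ) : EReal)
      ∧ (A = Set.univ → gameEntropy A = ⊥)
      ∧ (A = (∅ : Set (X → ℝ)) → gameEntropy A = ⊤) := by
  have hl2 : 0 < Real.log 2 := Real.log_pos (by norm_num)
  have huniv : A = Set.univ → gameEntropy A = ⊥ := fun h => by
    unfold gameEntropy; rw [if_pos h]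
  have main : gameEntropy A
        = ⨅ a ∈ A, ⨆ p ∈ {p ∈ probSimplex X | ∑ x, p x * a x ≤ 0},
            ((shannonEntropy p : ℝ) : EReal) := by
    by_cases hU : A = Set.univ
    · rw [huniv hU]
      symm
      rw [eq_bot_iff]
      refine iInf₂_le_of_le (fun _ => 1) (hU ▸ Set.mem_univ _) ?_
      refine iSup₂_le fun p hp => ?_
      exfalso
      have h1 := hp.1.2
      have h2 := hp.2
      simp only [mul_one] at h2
      linarith
    · unfold gameEntropy
      rw [if_neg hU]
      apply le_antisymm
      · refine le_iInf₂ fun a ha => ?_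
        refine le_of_forall_gt_imp_ge_of_dense fun c hc => ?_
        obtain ⟨R', h1, h2⟩ := EReal.lt_iff_exists_real_btwn.1 hc
        obtain ⟨R, h3, h4⟩ := EReal.lt_iff_exists_real_btwn.1 h2
        have hRR : R' < R := by exact_mod_cast h3
        refine le_trans ?_ h4.le
        have hsup : ∀ p ∈ probSimplex X, ∑ x, p x * a x ≤ 0 → shannonEntropy p < R' := by
          intro p hp hpa
          have : ((shannonEntropy p : ℝ) : EReal) < R' :=
            lt_of_le_of_lt (le_iSup₂_of_le p (⟨hp, hpa⟩ : p ∈ {p ∈ probSimplex X | ∑ x, p x * a x ≤ 0}) le_rfl) h1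
          exact_mod_cast this
        obtain ⟨x0, hx0⟩ := exists_nonpos_of_proper A hA hU a ha
        haveI : Nonempty X := ⟨x0⟩
        obtain ⟨lam, hlam, p, hp, hpa, hlog⟩ := duality a ⟨x0, hx0⟩ ((R - R') * Real.log 2)
          (mul_pos (by linarith) hl2)
        have hR0 : 0 ≤ R := by
          have := entropy_nonneg_aux p hp
          have := hsup p hp hpa
          linarith
        apply sInf_le
        refine ⟨R, hR0, rfl, fun n₀ _ ε hε _ => ?_⟩
        refine achiev_aux A hA a ha lam R hlam hR0 ?_ n₀ ε hε
        rw [← entropy_nat] at hlog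
        have hZpos : 0 < ∑ x, Real.exp (-lam * a x) :=
          Finset.sum_pos (fun x _ => Real.exp_pos _) Finset.univ_nonempty
        rw [← Real.log_lt_log_iff hZpos (by positivity), Real.log_rpow (by norm_num)]
        have := mul_lt_mul_of_pos_right (hsup p hp hpa) hl2
        linarith
      · refine le_sInf ?_
        rintro c ⟨R, hR, rfl, hwin⟩
        by_contra! hlt
        obtain ⟨r, h1, h2⟩ := EReal.lt_iff_exists_real_btwn.1 hlt
        have hRr : R < r := by exact_mod_cast h1
        by_cases hX : Nonempty X
        · refine converse_aux A R r hR hRr (fun a ha => ?_) hwin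
          have h3 := lt_of_lt_of_le h2 (iInf₂_le a ha)
          obtain ⟨p, h4⟩ := lt_iSup_iff.1 h3
          obtain ⟨hp, h5⟩ := lt_iSup_iff.1 h4
          exact ⟨p, hp.1, hp.2, by exact_mod_cast h5.le⟩
        · obtain ⟨n, hn, w, enc, dec, hw, -⟩ := hwin 1 one_pos (1/2) (by norm_num) (by norm_num)
          obtain ⟨x, -⟩ := exists_nonpos_of_proper A hA hU (w ⟨0, hn⟩ Fin.elim0) (hw _ _)
          exact hX ⟨x⟩
  refine ⟨main, huniv, fun h => ?_⟩
  rw [main, h]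
  simp

end
end
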